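/- In S(F₃;ℂ), with γ = g₂g₁⁻¹g₃g₁g₃⁻¹ and δ = g₁⁻¹g₃g₁g₃⁻¹g₂, one has Φ(Q) = [γg₃] − [δg₃], where Q = x₁x₃x₁₃x₂₃ − x₁₃²x₂₃ − x₁²x₂₃ − x₁x₃²x₁₂₃ + x₃x₁₃x₁₂₃ + 2x₁x₁₂₃ + x₁x₃x₁₂ − 2x₁₂x₁₃. -/

import Mathlib

open MvPolynomial

noncomputable section

def skeinIdeal (R G : Type*) [CommRing R] [Group G] : Ideal (MvPolynomial G R) :=
  Ideal.span ({X (1 : G) - 2} ∪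
    {p | ∃ g h : G, p = X g * X h - X (g * h) - X (g * h⁻¹)})

abbrev SkeinAlgebra (R G : Type*) [CommRing R] [Group G] :=
  MvPolynomial G R ⧸ skeinIdeal R G

def cl (R : Type*) {G : Type*} [CommRing R] [Group G] (g : G) : SkeinAlgebra R G :=
  Ideal.Quotient.mk (skeinIdeal R G) (X g)

/-- The free group on three generators. -/
abbrev F3 := FreeGroup (Fin 3)

def g1 : F3 := FreeGroup.of 0
def g2 : F3 := FreeGroup.of 1
def g3 : F3 := FreeGroup.of 2

/-- The words `g₁, g₂, g₃, g₁g₂, g₁g₃, g₂g₃, g₁g₂g₃` indexed by the seven variables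
`x₁, x₂, x₃, x₁₂, x₁₃, x₂₃, x₁₂₃`. -/
def word : Fin 7 → F3 := ![g1, g2, g3, g1 * g2, g1 * g3, g2 * g3, g1 * g2 * g3]

/-- `Φ : ℂ[x₁,…,x₁₂₃] → S(F₃;ℂ)`, `x_{i₁⋯i_k} ↦ [g_{i₁}⋯g_{i_k}]`. -/
def Phi : MvPolynomial (Fin 7) ℂ →ₐ[ℂ] SkeinAlgebra ℂ F3 :=
  aeval fun i => cl ℂ (word i)

-- the seven variables
def x1 : MvPolynomial (Fin 7) ℂ := X 0
def x2 : MvPolynomial (Fin 7) ℂ := X 1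
def x3 : MvPolynomial (Fin 7) ℂ := X 2
def x12 : MvPolynomial (Fin 7) ℂ := X 3
def x13 : MvPolynomial (Fin 7) ℂ := X 4
def x23 : MvPolynomial (Fin 7) ℂ := X 5
def x123 : MvPolynomial (Fin 7) ℂ := X 6

/-- The polynomial `K`. -/
def K : MvPolynomial (Fin 7) ℂ :=
  x123 ^ 2 - (x12 * x3 + x13 * x2 + x23 * x1 - x1 * x2 * x3) * x123
    + x1 ^ 2 + x2 ^ 2 + x3 ^ 2 + x12 ^ 2 + x23 ^ 2 + x13 ^ 2
    - x1 * x2 * x12 - x1 * x3 * x13 - x2 * x3 * x23 + x12 * x13 * x23 - 4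

def rgamma : F3 := g2 * g1⁻¹ * g3 * g1 * g3⁻¹
def rdelta : F3 := g1⁻¹ * g3 * g1 * g3⁻¹ * g2

def Q : MvPolynomial (Fin 7) ℂ :=
  x1*x3*x13*x23 - x13^2*x23 - x1^2*x23 - x1*x3^2*x123 + x3*x13*x123
    + 2*x1*x123 + x1*x3*x12 - 2*x12*x13

theorem cl_one {R G : Type*} [CommRing R] [Group G] : cl R (1 : G) = 2 := by
  have h : (X (1 : G) - 2 : MvPolynomial G R) ∈ skeinIdeal R G :=
    Ideal.subset_span (Or.inl rfl)
  exact (Ideal.Quotient.eq.2 h).trans (map_ofNat _ 2)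

theorem cl_mul_cl {R G : Type*} [CommRing R] [Group G] (g h : G) :
    cl R g * cl R h = cl R (g * h) + cl R (g * h⁻¹) := by
  have hm : (X g * X h - (X (g * h) + X (g * h⁻¹)) : MvPolynomial G R) ∈ skeinIdeal R G :=
    Ideal.subset_span (Or.inr ⟨g, h, by ring⟩)
  simpa [cl] using Ideal.Quotient.eq.2 hm

theorem cl_inv {R G : Type*} [CommRing R] [Group G] (g : G) : cl R g⁻¹ = cl R g := by
  have h := cl_mul_cl (R := R) 1 g
  rw [cl_one, one_mul, one_mul] at h
  linear_combination -h

theorem cl_mul_comm {R G : Type*} [CommRing R] [Group G] (g h : G) :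
    cl R (g * h) = cl R (h * g) := by
  have hinv := cl_inv (R := R) (g * h⁻¹)
  rw [mul_inv_rev, inv_inv] at hinv
  linear_combination cl_mul_cl (R := R) h g - cl_mul_cl (R := R) g h + hinv

theorem cl_mul_inv {R G : Type*} [CommRing R] [Group G] (g h : G) :
    cl R (g * h⁻¹) = cl R g * cl R h - cl R (g * h) := by
  linear_combination -cl_mul_cl (R := R) g h

theorem cl_mul_mul_add {R G : Type*} [CommRing R] [Group G] (a b c : G) :
    cl R (a * b * c) + cl R (a * c * b) =
      cl R a * cl R (b * c) + cl R b * cl R (a * c) + cl R c * cl R (a * b)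
        - cl R a * cl R b * cl R c := by
  have h₀ := cl_mul_cl (R := R) a b
  have h₁ := cl_mul_cl (R := R) a (b * c)
  have h₂ := cl_mul_cl (R := R) (a * c) b
  have h₃ := cl_mul_cl (R := R) (b⁻¹ * a) c
  have h₄ := cl_mul_comm (R := R) (a * c) b⁻¹
  have h₅ := cl_mul_comm (R := R) (a * c⁻¹) b⁻¹
  have h₆ := cl_mul_comm (R := R) a b⁻¹
  simp only [mul_inv_rev, ← mul_assoc] at *
  linear_combination cl R c * h₀ - h₁ - h₂ + h₃ - h₄ - h₅ + cl R c * h₆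

/-- The trace identity `[b a⁻¹ c a]` in terms of the classes of `a, b, c` and their products. -/
theorem cl_mul_inv_mul_mul {R G : Type*} [CommRing R] [Group G] (a b c : G) :
    cl R (b * a⁻¹ * c * a) =
      cl R (a * b) * (cl R a * cl R c - cl R (a * c))
        - cl R a * (cl R (a * b) * cl R c - cl R (a * b * c))
        + (cl R b * cl R c - cl R (b * c)) := by
  have h₁ := cl_mul_comm (R := R) (b * a⁻¹ * c) a
  have h₂ := cl_mul_cl (R := R) (a * b) (a⁻¹ * c)
  have h₃ := cl_mul_inv (R := R) c a
  have h₄ := cl_mul_comm (R := R) c a⁻¹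
  have h₅ := cl_mul_comm (R := R) c a
  have h₆ := cl_mul_cl (R := R) (a * b * c⁻¹) a
  have h₇ := cl_mul_comm (R := R) (a * b * c⁻¹) a⁻¹
  have h₈ := cl_mul_inv (R := R) (a * b) c
  have h₉ := cl_mul_inv (R := R) b c
  simp only [mul_inv_rev, inv_inv, ← mul_assoc, inv_mul_cancel, one_mul] at *
  linear_combination h₁ - h₂ - cl R (a * b) * (h₄ - h₃ + h₅) + h₆ + h₇ + h₉ - cl R a * h₈

/-- The trace identity for `[c a c b]`. -/
theorem cl_mul_mul_mul {R G : Type*} [CommRing R] [Group G] (a b c : G) :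
    cl R (c * a * c * b) =
      cl R (a * c) * cl R (b * c) - (cl R a * cl R b - cl R (a * b)) := by
  have h₁ := cl_mul_cl (R := R) (c * a) (c * b)
  have h₂ := cl_mul_comm (R := R) c a
  have h₃ := cl_mul_comm (R := R) c b
  have h₄ := cl_mul_comm (R := R) (c * a * b⁻¹) c⁻¹
  have h₅ := cl_mul_inv (R := R) a b
  simp only [mul_inv_rev, ← mul_assoc, inv_mul_cancel, one_mul] at *
  linear_combination -h₁ - h₄ - h₅ + cl R (c * b) * h₂ + cl R (a * c) * h₃

/-- Reduction of `[a⁻¹ c a c⁻¹ b c]` to classes of positive words. -/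
theorem cl_conj_mul {R G : Type*} [CommRing R] [Group G] (a b c : G) :
    cl R (a⁻¹ * c * a * c⁻¹ * b * c) =
      cl R c * (cl R a * (cl R c * cl R (a * b * c) - cl R (a * b))
          - (cl R (a * b * c) * cl R (a * c) - cl R b))
        - (cl R a * (cl R c * cl R (c * a * c * b) - cl R (a * c * b))
          - (cl R (a * c) * cl R (c * a * c * b) - cl R (b * c))) := by
  have h₁ := cl_mul_comm (R := R) (a⁻¹ * c * a * c⁻¹) (b * c)
  have h₂ := cl_mul_inv (R := R) (b * c * a⁻¹ * c * a) c
  have h₃ := cl_mul_comm (R := R) (b * c * a⁻¹) (c * a)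
  have h₄ := cl_mul_inv (R := R) (c * a * b * c) a
  have h₅ := cl_mul_comm (R := R) c (a * b * c)
  have h₆ := cl_mul_cl (R := R) (a * b * c) c
  have h₇ := cl_mul_comm (R := R) c (a * b * c * a)
  have h₈ := cl_mul_cl (R := R) (a * b * c) (a * c)
  have h₉ := cl_mul_comm (R := R) (a * b) a⁻¹
  have h₁₀ := cl_mul_comm (R := R) (b * c * a⁻¹) (c * a * c)
  have h₁₁ := cl_mul_inv (R := R) (c * a * c * b * c) a
  have h₁₂ := cl_mul_cl (R := R) (c * a * c * b) c
  have h₁₃ := cl_mul_comm (R := R) (c * a * c * b) c⁻¹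
  have h₁₄ := cl_mul_cl (R := R) (c * a * c * b) (c * a)
  have h₁₅ := cl_mul_comm (R := R) (c * a * c * b * a⁻¹) c⁻¹
  have h₁₆ := cl_mul_comm (R := R) (a * c * b) a⁻¹
  have h₁₇ := cl_mul_comm (R := R) c a
  have h₁₈ := cl_mul_comm (R := R) c b
  simp only [mul_inv_rev, ← mul_assoc, inv_mul_cancel, one_mul, mul_inv_cancel_right] at *
  linear_combination h₁ + h₂ + cl R c * (h₃ + h₄ + cl R a * (h₅ - h₆) - (h₇ - h₈ - h₉))
    - (h₁₀ + h₁₁ - cl R a * (h₁₂ + h₁₃)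
      - (cl R (c * a * c * b) * h₁₇ - h₁₄ - h₁₅ - h₁₆ - h₁₈))

theorem phi_Q_gamma_g3 : Phi Q = cl ℂ (rgamma * g3) - cl ℂ (rdelta * g3) := by
  have hγ : rgamma * g3 = g2 * g1⁻¹ * g3 * g1 := by simp [rgamma]
  have hPhi : Phi Q =
      cl ℂ g1 * cl ℂ g3 * cl ℂ (g1 * g3) * cl ℂ (g2 * g3) - cl ℂ (g1 * g3) ^ 2 * cl ℂ (g2 * g3)
        - cl ℂ g1 ^ 2 * cl ℂ (g2 * g3) - cl ℂ g1 * cl ℂ g3 ^ 2 * cl ℂ (g1 * g2 * g3)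
        + cl ℂ g3 * cl ℂ (g1 * g3) * cl ℂ (g1 * g2 * g3) + 2 * cl ℂ g1 * cl ℂ (g1 * g2 * g3)
        + cl ℂ g1 * cl ℂ g3 * cl ℂ (g1 * g2) - 2 * cl ℂ (g1 * g2) * cl ℂ (g1 * g3) := by
    simp [Phi, Q, x1, x3, x12, x13, x23, x123, word]
  rw [hPhi, hγ, rdelta, cl_mul_inv_mul_mul, cl_conj_mul, cl_mul_mul_mul]
  linear_combination cl ℂ g1 * cl_mul_mul_add (R := ℂ) g1 g2 g3
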